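/- P_{C,π} ▷ (c ⊗ w) = c ⊗ w for all c ∈ C and w ∈ V_π, i.e. P_{C,π} acts as the identity on V_{C,π}; moreover, if (C', π') is another such datum with C ≠ C' or π ≇ π', then P_{C,π} acts as zero on V_{C',π'}. -/

import Mathlib

/-!
The projector `P_{C,π}` acts as the identity on `V_{C,π}` and as zero on `V_{C',π'}`
whenever `C ≠ C'` or `π ≇ π'`.
-/

noncomputable section

open scoped BigOperators Classical

set_option linter.unusedSectionVars false

/-- The quantum double `D(G)` as a vector space: the value at `(s, h)` is the
coefficient of the basis element `δ_s ⊗ h`. -/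
abbrev DoubleDG (G : Type*) := G × G → ℂ

/-- The basis element `δ_s ⊗ h` of `D(G)`. -/
def DGbasis {G : Type*} [DecidableEq G] (s h : G) : DoubleDG G :=
  fun p => if p = (s, h) then 1 else 0

/-- The multiplication of `D(G)`, determined by
`(δ_s ⊗ h)(δ_t ⊗ g) = [s = hth⁻¹] (δ_s ⊗ hg)`. -/
def DGmul {G : Type*} [Group G] [Fintype G] (x y : DoubleDG G) : DoubleDG G :=
  fun p => ∑ h : G, x (p.1, h) * y (h⁻¹ * p.1 * h, h⁻¹ * p.2)

/-- The unit `Σ_s δ_s ⊗ e` of `D(G)`. -/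
def DGone {G : Type*} [Group G] [DecidableEq G] : DoubleDG G :=
  fun p => if p.2 = 1 then 1 else 0

/-- The antipode of `D(G)`: `S(δ_g ⊗ h) = δ_{h⁻¹g⁻¹h} ⊗ h⁻¹`. -/
def DGantipode {G : Type*} [Group G] (x : DoubleDG G) : DoubleDG G :=
  fun p => x (p.2⁻¹ * p.1⁻¹ * p.2, p.2⁻¹)

variable {G : Type*} [Group G] [Fintype G] [DecidableEq G]

/-- The conjugacy class of `r`, as a subtype. -/
abbrev ConjCl (r : G) := {x : G // IsConj r x}

lemma isConj_conj_right {r c : G} (hc : IsConj r c) (h : G) :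
    IsConj r (h⁻¹ * c * h) := by
  obtain ⟨g, hg⟩ := isConj_iff.1 hc
  refine isConj_iff.2 ⟨h⁻¹ * g, ?_⟩
  rw [← hg]; group

/-- The cocycle `ζ_c(g) = q_{g c g⁻¹}⁻¹ * g * q_c`. -/
def zeta {G : Type*} [Group G] (q : G → G) (c g : G) : G :=
  (q (g * c * g⁻¹))⁻¹ * g * q c

variable {W : Type*} [AddCommGroup W] [Module ℂ W]

/-- The action of the basis element `δ_s ⊗ h` of `D(G)` on `V_{C,π} = ℂC ⊗ V_π`,
realised as `C → V_π`: on the basis vector `c ⊗ w` it is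
`(δ_s ⊗ h) ▷ (c ⊗ w) = [s = hch⁻¹] (hch⁻¹ ⊗ π(ζ_c(h)) w)`. -/
def siteAct (r : G) (q : G → G) (π : G → Module.End ℂ W) (s h : G) :
    Module.End ℂ (ConjCl r → W) where
  toFun v := fun c =>
    if (c : G) = s then
      π (zeta q (h⁻¹ * c * h) h) (v ⟨h⁻¹ * c * h, isConj_conj_right c.2 h⟩)
    else 0
  map_add' v w := by
    funext c
    by_cases hcs : (c : G) = s <;> simp [hcs]
  map_smul' a v := by
    funext c
    by_cases hcs : (c : G) = s <;> simp [hcs]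

/-- The linear extension of the site action to all of `D(G)`. -/
def rep (r : G) (q : G → G) (π : G → Module.End ℂ W) (x : DoubleDG G) :
    Module.End ℂ (ConjCl r → W) :=
  ∑ s : G, ∑ h : G, x (s, h) • siteAct r q π s h

/-- The projector
`P_{C,π} = (dim V_π/|C_G|) Σ_{c∈C} Σ_{n∈C_G} Tr_π(n⁻¹) δ_c ⊗ q_c n q_c⁻¹ ∈ D(G)`. -/
def Pproj (r : G) (q : G → G) (π : G → Module.End ℂ W)
    [FiniteDimensional ℂ W] : DoubleDG G :=
  ((Module.finrank ℂ W : ℂ) / ((Finset.univ.filter fun n : G => n * r = r * n).card : ℂ)) •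
    ∑ c : G, ∑ n : G,
      if IsConj r c ∧ n * r = r * n then
        (LinearMap.trace ℂ W (π n⁻¹)) • DGbasis c (q c * n * (q c)⁻¹)
      else 0

section Schur

variable {H V V' : Type*} [Group H] [AddCommGroup V] [Module ℂ V] [AddCommGroup V'] [Module ℂ V']

/-- A representation all of whose invariant subspaces are trivial; the zero representation
is allowed. -/
def OnlyTrivialInvariant (ρ : Representation ℂ H V) : Prop :=
  ∀ U : Submodule ℂ V, (∀ n : H, ∀ w ∈ U, ρ n w ∈ U) → U = ⊥ ∨ U = ⊤

/-- Schur's lemma: a nonzero intertwiner is an isomorphism. -/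
lemma OnlyTrivialInvariant.eq_zero_or_bijective {ρ : Representation ℂ H V}
    {σ : Representation ℂ H V'} (hρ : OnlyTrivialInvariant ρ) (hσ : OnlyTrivialInvariant σ)
    (f : V →ₗ[ℂ] V') (hf : ∀ n w, f (ρ n w) = σ n (f w)) :
    f = 0 ∨ Function.Bijective f := by
  rcases hρ (LinearMap.ker f) fun n w hw => by
      rw [LinearMap.mem_ker] at hw ⊢
      rw [hf, hw, map_zero] with hk | hk
  · rcases hσ (LinearMap.range f) fun n w hw => by
        obtain ⟨x, rfl⟩ := hw
        exact ⟨ρ n x, hf n x⟩ with hr | hr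
    · exact Or.inl (LinearMap.range_eq_bot.1 hr)
    · exact Or.inr ⟨LinearMap.ker_eq_bot.1 hk, LinearMap.range_eq_top.1 hr⟩
  · exact Or.inl (LinearMap.ker_eq_top.1 hk)

/-- Schur's lemma: a self-intertwiner is a scalar. -/
lemma OnlyTrivialInvariant.exists_eq_smul_one [FiniteDimensional ℂ V]
    {ρ : Representation ℂ H V} (hρ : OnlyTrivialInvariant ρ)
    (f : Module.End ℂ V) (hf : ∀ n w, f (ρ n w) = ρ n (f w)) :
    ∃ a : ℂ, f = a • (1 : Module.End ℂ V) := by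
  rcases subsingleton_or_nontrivial V with hV | hV
  · exact ⟨0, Subsingleton.elim _ _⟩
  obtain ⟨a, ha⟩ := Module.End.exists_eigenvalue f
  refine ⟨a, ?_⟩
  rcases hρ (f.eigenspace a) fun n w hw => by
      rw [Module.End.mem_eigenspace_iff] at hw ⊢
      rw [hf, hw, map_smul] with h | h
  · exact absurd h ha
  · ext w
    exact Module.End.mem_eigenspace_iff.1 (h ▸ Submodule.mem_top : w ∈ f.eigenspace a)

variable [Fintype H]

/-- The average `Σ_n σ(n) φ ρ(n⁻¹)` of a linear map. -/
def groupAverage (ρ : Representation ℂ H V) (σ : Representation ℂ H V') (φ : V →ₗ[ℂ] V') :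
    V →ₗ[ℂ] V' :=
  ∑ n : H, σ n ∘ₗ φ ∘ₗ ρ n⁻¹

lemma groupAverage_apply (ρ : Representation ℂ H V) (σ : Representation ℂ H V')
    (φ : V →ₗ[ℂ] V') (w : V) : groupAverage ρ σ φ w = ∑ n : H, σ n (φ (ρ n⁻¹ w)) := by
  simp [groupAverage]

lemma groupAverage_comm (ρ : Representation ℂ H V) (σ : Representation ℂ H V')
    (φ : V →ₗ[ℂ] V') (m : H) (w : V) :
    groupAverage ρ σ φ (ρ m w) = σ m (groupAverage ρ σ φ w) := by
  rw [groupAverage_apply, groupAverage_apply, map_sum,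
    ← Equiv.sum_comp (Equiv.mulLeft m) fun n => σ n (φ (ρ n⁻¹ (ρ m w)))]
  refine Finset.sum_congr rfl fun n _ => ?_
  simp only [Equiv.coe_mulLeft, ← Module.End.mul_apply, ← map_mul]
  simp

lemma trace_groupAverage_self [FiniteDimensional ℂ V] (ρ : Representation ℂ H V)
    (φ : Module.End ℂ V) :
    LinearMap.trace ℂ V (groupAverage ρ ρ φ) = Fintype.card H * LinearMap.trace ℂ V φ := by
  have h : ∀ n : H, LinearMap.trace ℂ V (ρ n ∘ₗ φ ∘ₗ ρ n⁻¹) = LinearMap.trace ℂ V φ := by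
    intro n
    change LinearMap.trace ℂ V (ρ n * (φ * ρ n⁻¹)) = _
    rw [LinearMap.trace_mul_comm, mul_assoc, ← map_mul]
    simp
  simp [groupAverage, h]

/-- The character-weighted sum of `σ` is a sum of averages of rank-one maps. -/
lemma sum_trace_smul_eq [FiniteDimensional ℂ V] (ρ : Representation ℂ H V)
    (σ : Representation ℂ H V') (x : V') :
    ∑ n : H, LinearMap.trace ℂ V (ρ n⁻¹) • σ n x =
      ∑ i, groupAverage ρ σ (((Module.finBasis ℂ V).coord i).smulRight x)
        (Module.finBasis ℂ V i) := by
  simp only [groupAverage_apply, LinearMap.smulRight_apply, map_smul]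
  rw [Finset.sum_comm]
  refine Finset.sum_congr rfl fun n _ => ?_
  rw [← Finset.sum_smul, LinearMap.trace_eq_matrix_trace ℂ (Module.finBasis ℂ V)]
  simp [Matrix.trace, LinearMap.toMatrix_apply]

/-- The character of `ρ` annihilates every non-isomorphic irreducible `σ`. -/
lemma sum_trace_smul_eq_zero [FiniteDimensional ℂ V] {ρ : Representation ℂ H V}
    {σ : Representation ℂ H V'} (hρ : OnlyTrivialInvariant ρ) (hσ : OnlyTrivialInvariant σ)
    (hne : ¬ ∃ f : V ≃ₗ[ℂ] V', ∀ n w, f (ρ n w) = σ n (f w)) (x : V') :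
    ∑ n : H, LinearMap.trace ℂ V (ρ n⁻¹) • σ n x = 0 := by
  rw [sum_trace_smul_eq]
  refine Finset.sum_eq_zero fun i _ => ?_
  rcases hρ.eq_zero_or_bijective hσ _ (groupAverage_comm ρ σ _) with h | h
  · rw [h, LinearMap.zero_apply]
  · exact absurd ⟨LinearEquiv.ofBijective _ h, groupAverage_comm ρ σ _⟩ hne

/-- The central idempotent attached to an irreducible `ρ` acts on it as the identity. -/
lemma finrank_smul_sum_trace_smul [FiniteDimensional ℂ V] {ρ : Representation ℂ H V}
    (hρ : OnlyTrivialInvariant ρ) (x : V) :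
    (Module.finrank ℂ V : ℂ) • ∑ n : H, LinearMap.trace ℂ V (ρ n⁻¹) • ρ n x =
      (Fintype.card H : ℂ) • x := by
  rw [sum_trace_smul_eq, Finset.smul_sum]
  set b := Module.finBasis ℂ V
  have key : ∀ i, (Module.finrank ℂ V : ℂ) • groupAverage ρ ρ ((b.coord i).smulRight x) (b i) =
      (Fintype.card H : ℂ) • b.repr x i • b i := by
    intro i
    obtain ⟨a, ha⟩ := hρ.exists_eq_smul_one _ (groupAverage_comm ρ ρ ((b.coord i).smulRight x))
    have ht := trace_groupAverage_self ρ ((b.coord i).smulRight x)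
    rw [ha, map_smul, LinearMap.trace_one, LinearMap.trace_smulRight] at ht
    rw [ha, LinearMap.smul_apply, Module.End.one_apply, smul_smul, smul_smul, mul_comm]
    simpa using congrArg (· • b i) ht
  simp only [key, ← Finset.smul_sum, b.sum_repr]

end Schur

section DoubleAction

lemma rep_smul (r : G) (q : G → G) (π : G → Module.End ℂ W) (a : ℂ) (x : DoubleDG G) :
    rep r q π (a • x) = a • rep r q π x := by
  simp [rep, Finset.smul_sum, smul_smul]

lemma rep_sum {ι : Type*} (t : Finset ι) (r : G) (q : G → G) (π : G → Module.End ℂ W)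
    (x : ι → DoubleDG G) : rep r q π (∑ i ∈ t, x i) = ∑ i ∈ t, rep r q π (x i) := by
  simp only [rep, Finset.sum_apply, Finset.sum_smul]
  rw [Finset.sum_comm (s := t)]
  exact Finset.sum_congr rfl fun s _ => Finset.sum_comm

lemma rep_zero (r : G) (q : G → G) (π : G → Module.End ℂ W) : rep r q π 0 = 0 := by
  simp [rep]

lemma rep_DGbasis (r : G) (q : G → G) (π : G → Module.End ℂ W) (s h : G) :
    rep r q π (DGbasis s h) = siteAct r q π s h := by
  simp [rep, DGbasis, Prod.ext_iff, ite_and, ite_smul]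

lemma siteAct_apply (r : G) (q : G → G) (π : G → Module.End ℂ W) (s h : G)
    (v : ConjCl r → W) (c : ConjCl r) :
    siteAct r q π s h v c = if (c : G) = s then
      π (zeta q (h⁻¹ * c * h) h) (v ⟨h⁻¹ * c * h, isConj_conj_right c.2 h⟩) else 0 := rfl

lemma siteAct_eq_zero {r s : G} (hs : ¬ IsConj r s) (q : G → G) (π : G → Module.End ℂ W)
    (h : G) : siteAct r q π s h = 0 := by
  refine LinearMap.ext fun v => funext fun c => ?_
  rw [siteAct_apply, if_neg fun hc : (c : G) = s => hs (hc ▸ c.2)]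
  rfl

/-- `δ_c ⊗ q_c n q_c⁻¹` acts on `c ⊗ w` through `π n`. -/
lemma siteAct_conj_apply {r : G} {q : G → G} (hq : ∀ c, IsConj r c → q c * r * (q c)⁻¹ = c)
    (π : G → Module.End ℂ W) {n : G} (hn : n * r = r * n) (s : G) (v : ConjCl r → W)
    (c : ConjCl r) :
    siteAct r q π s (q s * n * (q s)⁻¹) v c = if (c : G) = s then π n (v c) else 0 := by
  rw [siteAct_apply]
  split_ifs with hcs
  · subst hcs
    have hc := hq c c.2
    have hfix : (q c * n * (q c)⁻¹)⁻¹ * c * (q c * n * (q c)⁻¹) = (c : G) := by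
      have h1 : (q c * n * (q c)⁻¹)⁻¹ * (q c * r * (q c)⁻¹) * (q c * n * (q c)⁻¹) =
          q c * (n⁻¹ * (r * n)) * (q c)⁻¹ := by group
      rw [hc, ← hn, inv_mul_cancel_left, hc] at h1
      exact h1
    have hfix' : (q c * n * (q c)⁻¹) * c * (q c * n * (q c)⁻¹)⁻¹ = (c : G) := by
      rw [mul_inv_eq_iff_eq_mul, eq_comm, ← inv_mul_eq_iff_eq_mul, ← mul_assoc, hfix]
    have hz : zeta q (c : G) (q c * n * (q c)⁻¹) = n := by
      rw [zeta, hfix']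
      group
    have hv : (⟨_, isConj_conj_right c.2 (q c * n * (q c)⁻¹)⟩ : ConjCl r) = c :=
      Subtype.ext hfix
    rw [hv, hfix, hz]
  · rfl

lemma rep_Pproj [FiniteDimensional ℂ W] {W' : Type*} [AddCommGroup W'] [Module ℂ W']
    (r r' : G) (q q' : G → G) (π : G → Module.End ℂ W) (π' : G → Module.End ℂ W') :
    rep r' q' π' (Pproj r q π) =
      ((Module.finrank ℂ W : ℂ) /
        ((Finset.univ.filter fun n : G => n * r = r * n).card : ℂ)) •
      ∑ c : G, ∑ n : G, if IsConj r c ∧ n * r = r * n then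
        LinearMap.trace ℂ W (π n⁻¹) • siteAct r' q' π' c (q c * n * (q c)⁻¹) else 0 := by
  rw [Pproj, rep_smul, rep_sum]
  simp only [rep_sum, apply_ite (rep r' q' π'), rep_smul, rep_DGbasis, rep_zero]

lemma rep_Pproj_apply [FiniteDimensional ℂ W] {W' : Type*} [AddCommGroup W'] [Module ℂ W']
    {r : G} {q : G → G} (hq : ∀ c, IsConj r c → q c * r * (q c)⁻¹ = c)
    (π : G → Module.End ℂ W) (π' : G → Module.End ℂ W') (v : ConjCl r → W') (c : ConjCl r) :
    rep r q π' (Pproj r q π) v c =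
      ((Module.finrank ℂ W : ℂ) / (Fintype.card {n : G // n * r = r * n} : ℂ)) •
      ∑ n : {n : G // n * r = r * n}, LinearMap.trace ℂ W (π (n : G)⁻¹) • π' n (v c) := by
  have hterm : ∀ s n : G, (if IsConj r s ∧ n * r = r * n then
        LinearMap.trace ℂ W (π n⁻¹) • siteAct r q π' s (q s * n * (q s)⁻¹) else 0) v c =
      if (c : G) = s then
        if n * r = r * n then LinearMap.trace ℂ W (π n⁻¹) • π' n (v c) else 0 else 0 := by
    intro s n
    by_cases hn : n * r = r * n
    · by_cases hrs : IsConj r s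
      · rw [if_pos ⟨hrs, hn⟩, if_pos hn, LinearMap.smul_apply, Pi.smul_apply,
          siteAct_conj_apply hq π' hn, smul_ite, smul_zero]
      · rw [if_neg fun h => hrs h.1, if_neg fun h : (c : G) = s => hrs (h ▸ c.2)]
        rfl
    · simp [hn]
  rw [rep_Pproj, Fintype.card_subtype]
  simp only [LinearMap.smul_apply, LinearMap.sum_apply, Pi.smul_apply, Finset.sum_apply, hterm]
  rw [Finset.sum_comm]
  simp only [Finset.sum_ite_eq, Finset.mem_univ, if_true]
  rw [← Finset.sum_filter, Finset.sum_subtype (p := fun n => n * r = r * n) _ (by simp)]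

/-- A map that is multiplicative on the centralizer of `r`, as a representation of it. -/
def centralizerRep {r : G} {π : G → Module.End ℂ W} (h1 : π 1 = 1)
    (hmul : ∀ m n : G, m * r = r * m → n * r = r * n → π (m * n) = π m * π n) :
    Representation ℂ (Subgroup.centralizer {r}) W where
  toFun n := π n
  map_one' := h1
  map_mul' m n := hmul m n (Subgroup.mem_centralizer_singleton_iff.1 m.2)
    (Subgroup.mem_centralizer_singleton_iff.1 n.2)

lemma onlyTrivialInvariant_centralizerRep {r : G} {π : G → Module.End ℂ W} (h1 : π 1 = 1)
    (hmul : ∀ m n : G, m * r = r * m → n * r = r * n → π (m * n) = π m * π n)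
    (hirr : ∀ U : Submodule ℂ W,
      (∀ n : G, n * r = r * n → ∀ w ∈ U, π n w ∈ U) → U = ⊥ ∨ U = ⊤) :
    OnlyTrivialInvariant (centralizerRep h1 hmul) := fun U hU =>
  hirr U fun n hn => hU ⟨n, Subgroup.mem_centralizer_singleton_iff.2 hn⟩

/-- Elements commuting with `r`, as the centralizer of `r`. -/
def commutingEquivCentralizer (r : G) :
    {n : G // n * r = r * n} ≃ Subgroup.centralizer {r} :=
  Equiv.subtypeEquivRight fun _ => Subgroup.mem_centralizer_singleton_iff.symm

lemma rep_Pproj_apply_eq_centralizer_sum [FiniteDimensional ℂ W] {W' : Type*} [AddCommGroup W']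
    [Module ℂ W'] {r : G} {q : G → G} (hq : ∀ c, IsConj r c → q c * r * (q c)⁻¹ = c)
    {π : G → Module.End ℂ W} {π' : G → Module.End ℂ W'} (h1 : π 1 = 1)
    (hmul : ∀ m n : G, m * r = r * m → n * r = r * n → π (m * n) = π m * π n)
    (h1' : π' 1 = 1)
    (hmul' : ∀ m n : G, m * r = r * m → n * r = r * n → π' (m * n) = π' m * π' n)
    (v : ConjCl r → W') (c : ConjCl r) :
    rep r q π' (Pproj r q π) v c =
      ((Module.finrank ℂ W : ℂ) / (Fintype.card (Subgroup.centralizer {r}) : ℂ)) •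
      ∑ n : Subgroup.centralizer {r}, LinearMap.trace ℂ W (centralizerRep h1 hmul n⁻¹) •
        centralizerRep h1' hmul' n (v c) := by
  rw [rep_Pproj_apply hq, Fintype.card_congr (commutingEquivCentralizer r),
    ← (commutingEquivCentralizer r).sum_comp]
  rfl

end DoubleAction

theorem statement5
    {W' : Type*} [AddCommGroup W'] [Module ℂ W']
    [FiniteDimensional ℂ W] [FiniteDimensional ℂ W']
    (r r' : G) (q q' : G → G)
    (hq : ∀ c, IsConj r c → q c * r * (q c)⁻¹ = c)
    (hq' : ∀ c, IsConj r' c → q' c * r' * (q' c)⁻¹ = c)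
    (π : G → Module.End ℂ W) (π' : G → Module.End ℂ W')
    (hπ1 : π 1 = 1)
    (hπmul : ∀ m n : G, m * r = r * m → n * r = r * n → π (m * n) = π m * π n)
    (hπ'1 : π' 1 = 1)
    (hπ'mul : ∀ m n : G, m * r' = r' * m → n * r' = r' * n → π' (m * n) = π' m * π' n)
    (hirr : ∀ U : Submodule ℂ W,
      (∀ n : G, n * r = r * n → ∀ w ∈ U, π n w ∈ U) → U = ⊥ ∨ U = ⊤)
    (hirr' : ∀ U : Submodule ℂ W',
      (∀ n : G, n * r' = r' * n → ∀ w ∈ U, π' n w ∈ U) → U = ⊥ ∨ U = ⊤)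
    (hbase : IsConj r r' → r = r' ∧ q = q') :
    rep (W := W) r q π (Pproj r q π) = 1 ∧
    ((¬ IsConj r r' ∨
        ¬ ∃ f : W ≃ₗ[ℂ] W', ∀ n : G, n * r = r * n → ∀ w : W, f (π n w) = π' n (f w)) →
      rep (W := W') r' q' π' (Pproj r q π) = 0) := by
  constructor
  · refine LinearMap.ext fun v => funext fun c => ?_
    rw [rep_Pproj_apply_eq_centralizer_sum hq hπ1 hπmul hπ1 hπmul, div_eq_inv_mul, mul_smul,
      finrank_smul_sum_trace_smul (onlyTrivialInvariant_centralizerRep hπ1 hπmul hirr),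
      inv_smul_smul₀ (Nat.cast_ne_zero.2 Fintype.card_ne_zero)]
    rfl
  · intro h
    by_cases hrr : IsConj r r'
    · obtain ⟨rfl, rfl⟩ := hbase hrr
      have hne := h.resolve_left (not_not_intro hrr)
      refine LinearMap.ext fun v => funext fun c => ?_
      rw [rep_Pproj_apply_eq_centralizer_sum hq hπ1 hπmul hπ'1 hπ'mul,
        sum_trace_smul_eq_zero (onlyTrivialInvariant_centralizerRep hπ1 hπmul hirr)
          (onlyTrivialInvariant_centralizerRep hπ'1 hπ'mul hirr'), smul_zero]
      · rfl
      · rintro ⟨f, hf⟩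
        exact hne ⟨f, fun n hn => hf ⟨n, Subgroup.mem_centralizer_singleton_iff.2 hn⟩⟩
    · rw [rep_Pproj]
      refine (congrArg _ (Finset.sum_eq_zero fun c _ => Finset.sum_eq_zero fun n _ => ?_)).trans
        (smul_zero _)
      split_ifs with hc
      · rw [siteAct_eq_zero fun hc' => hrr (hc.1.trans hc'.symm), smul_zero]
      · rfl

end
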